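/- Let [C_1,…,C_r] be the W-characteristic set of ⟨P⟩ under the stated variable ordering, with C_i = [C_1,…,C_i] for 1 ≤ i ≤ r, and let k < r be the biggest integer such that C_k is normal. Let I_{k+1} = ini(C_{k+1}), y_l = lv(I_{k+1}), and Q = pquo(C_l, I_{k+1}, y_l). If I_{k+1} is R-reduced with respect to C_l, then prem(C_l, [C_1,…,C_{l−1}, I_{k+1}]) = 0 and prem(Q·C_{k+1}, C_k) = 0. -/

import Mathlib

open MvPolynomial

namespace CharSets

variable {n : ℕ} {K : Type*} [Field K]

/-- The coefficient of `x_i ^ d` in `F`, as a polynomial in the remaining variables. -/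
noncomputable def coefv (i : Fin n) (d : ℕ) (F : MvPolynomial (Fin n) K) :
    MvPolynomial (Fin n) K :=
  ∑ m ∈ F.support.filter (fun m => m i = d), monomial (Finsupp.erase i m) (F.coeff m)

/-- The leading coefficient of `F` with respect to the variable `x_i`. -/
noncomputable def lcv (i : Fin n) (F : MvPolynomial (Fin n) K) : MvPolynomial (Fin n) K :=
  coefv i (F.degreeOf i) F

/-- Auxiliary pseudo-division: computes (pseudo-quotient, pseudo-remainder) pairs,
with the first argument as fuel; the total power of the leading coefficient used is
exactly the fuel, so that starting with fuel `max(l - m + 1, 0)` yields the pair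
`(Q, R)` of the unique representation `lc(F,x_i)^q • G = Q*F + R` with
`q = max(l - m + 1, 0)` and `deg(R, x_i) < deg(F, x_i)`. -/
noncomputable def pdivAux (i : Fin n) (F : MvPolynomial (Fin n) K) :
    ℕ → MvPolynomial (Fin n) K × MvPolynomial (Fin n) K →
      MvPolynomial (Fin n) K × MvPolynomial (Fin n) K
  | 0, QR => QR
  | q + 1, QR =>
    if (QR.2).degreeOf i < F.degreeOf i then
      (lcv i F ^ (q + 1) * QR.1, lcv i F ^ (q + 1) * QR.2)
    else
      pdivAux i F q
        (lcv i F * QR.1 +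
            coefv i ((QR.2).degreeOf i) QR.2 * X i ^ ((QR.2).degreeOf i - F.degreeOf i),
          lcv i F * QR.2 -
            coefv i ((QR.2).degreeOf i) QR.2 * X i ^ ((QR.2).degreeOf i - F.degreeOf i) * F)

/-- The pseudo-remainder `prem(G, F, x_i)`. -/
noncomputable def prem (G F : MvPolynomial (Fin n) K) (i : Fin n) : MvPolynomial (Fin n) K :=
  (pdivAux i F (G.degreeOf i + 1 - F.degreeOf i) (0, G)).2

/-- The pseudo-quotient `pquo(G, F, x_i)`. -/
noncomputable def pquo (G F : MvPolynomial (Fin n) K) (i : Fin n) : MvPolynomial (Fin n) K :=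
  (pdivAux i F (G.degreeOf i + 1 - F.degreeOf i) (0, G)).1

/-- The class of `P`: the largest index (1-based) of a variable actually occurring in `P`;
the class of a constant is `0`. -/
noncomputable def cls (P : MvPolynomial (Fin n) K) : ℕ :=
  P.vars.sup fun i => (i : ℕ) + 1

/-- The degree of `G` in the leading variable of `P` (`0` if `P` is constant). -/
noncomputable def degLv (G P : MvPolynomial (Fin n) K) : ℕ :=
  if h : P.vars.Nonempty then G.degreeOf (P.vars.max' h) else 0

/-- `G` is R-reduced with respect to `P`, i.e. `deg(G, lv(P)) < deg(P, lv(P))`. -/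
def RReduced (G P : MvPolynomial (Fin n) K) : Prop :=
  degLv G P < degLv P P

/-- The initial of `P`: its leading coefficient w.r.t. its leading variable. -/
noncomputable def ini (P : MvPolynomial (Fin n) K) : MvPolynomial (Fin n) K :=
  if h : P.vars.Nonempty then lcv (P.vars.max' h) P else P

/-- Pseudo-remainder of `G` w.r.t. `F` in the leading variable of `F`
(in case `F` is constant, `m = 0` and the pseudo-remainder is `0`). -/
noncomputable def premLv (G F : MvPolynomial (Fin n) K) : MvPolynomial (Fin n) K :=
  if h : F.vars.Nonempty then prem G F (F.vars.max' h) else 0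

/-- Pseudo-quotient of `G` w.r.t. `F` in the leading variable of `F`. -/
noncomputable def pquoLv (G F : MvPolynomial (Fin n) K) : MvPolynomial (Fin n) K :=
  if h : F.vars.Nonempty then pquo G F (F.vars.max' h) else 0

/-- Iterated pseudo-remainder with respect to a triangular set `[T_1, …, T_r]`:
`prem(P, T) = prem(⋯prem(P, T_r, lv(T_r)), …, T_1, lv(T_1))`. -/
noncomputable def premTS (P : MvPolynomial (Fin n) K) (L : List (MvPolynomial (Fin n) K)) :
    MvPolynomial (Fin n) K :=
  L.foldr (fun T acc => premLv acc T) P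

/-- The Sylvester matrix of `F` and `G` with respect to the variable `x_i`. -/
noncomputable def sylvester (i : Fin n) (F G : MvPolynomial (Fin n) K) :
    Matrix (Fin (G.degreeOf i + F.degreeOf i)) (Fin (G.degreeOf i + F.degreeOf i))
      (MvPolynomial (Fin n) K) :=
  Matrix.of fun r c =>
    if (r : ℕ) < G.degreeOf i then
      if (r : ℕ) ≤ (c : ℕ) ∧ (c : ℕ) ≤ (r : ℕ) + F.degreeOf i then
        coefv i (F.degreeOf i + (r : ℕ) - (c : ℕ)) F
      else 0
    else
      if (r : ℕ) - G.degreeOf i ≤ (c : ℕ) ∧ (c : ℕ) ≤ (r : ℕ) then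
        coefv i (G.degreeOf i + ((r : ℕ) - G.degreeOf i) - (c : ℕ)) G
      else 0

/-- The resultant `res(F, G, x_i)` of `F` and `G` w.r.t. `x_i`
(the determinant of the Sylvester matrix). -/
noncomputable def resv (F G : MvPolynomial (Fin n) K) (i : Fin n) : MvPolynomial (Fin n) K :=
  (sylvester i F G).det

/-- Resultant of `F` and `G` w.r.t. the leading variable of `G`. -/
noncomputable def resLv (F G : MvPolynomial (Fin n) K) : MvPolynomial (Fin n) K :=
  if h : G.vars.Nonempty then resv F G (G.vars.max' h) else F

/-- Iterated resultant with respect to a triangular set: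
`res(F, T) = res(⋯res(F, T_r, lv(T_r)), …, T_1, lv(T_1))`. -/
noncomputable def resTS (F : MvPolynomial (Fin n) K) (L : List (MvPolynomial (Fin n) K)) :
    MvPolynomial (Fin n) K :=
  L.foldr (fun T acc => resLv acc T) F

/-- A triangular set: a nonempty ordered set of nonconstant polynomials with
strictly increasing classes. -/
def TriangularSet (L : List (MvPolynomial (Fin n) K)) : Prop :=
  L ≠ [] ∧ (∀ T ∈ L, 0 < cls T) ∧ L.Chain' fun A B => cls A < cls B

/-- An ascending set: either a single nonzero constant, or a triangular set in which
every later element is R-reduced with respect to every earlier one. -/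
def AscendingSet (L : List (MvPolynomial (Fin n) K)) : Prop :=
  (∃ a : K, a ≠ 0 ∧ L = [MvPolynomial.C a]) ∨
    (TriangularSet L ∧ L.Pairwise fun A B => RReduced B A)

/-- `F` has lower rank than `G`. -/
def rkLT (F G : MvPolynomial (Fin n) K) : Prop :=
  cls F < cls G ∨ (cls F = cls G ∧ 0 < cls F ∧ degLv F F < degLv G G)

/-- `F` and `G` have the same rank: neither has lower rank than the other. -/
def rkEQ (F G : MvPolynomial (Fin n) K) : Prop :=
  ¬ rkLT F G ∧ ¬ rkLT G F

/-- `B` has lower rank than `A` (as ascending sets). -/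
def ascLT (B A : List (MvPolynomial (Fin n) K)) : Prop :=
  (∃ j, j < min A.length B.length ∧
      (∀ i, i < j → rkEQ (A.getD i 0) (B.getD i 0)) ∧ rkLT (B.getD j 0) (A.getD j 0)) ∨
    (A.length < B.length ∧ ∀ i, i < A.length → rkEQ (A.getD i 0) (B.getD i 0))

/-- A Ritt characteristic set of the ideal `I`: an ascending set contained in `I`
of minimal rank among all ascending sets contained in `I`. -/
def RittCharSet (I : Ideal (MvPolynomial (Fin n) K)) (A : List (MvPolynomial (Fin n) K)) :
    Prop :=
  AscendingSet A ∧ (∀ a ∈ A, a ∈ I) ∧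
    ∀ B : List (MvPolynomial (Fin n) K), AscendingSet B → (∀ b ∈ B, b ∈ I) → ¬ ascLT B A

/-- The saturated ideal of a triangular set, as a set of polynomials. -/
def satTS (L : List (MvPolynomial (Fin n) K)) : Set (MvPolynomial (Fin n) K) :=
  {F | ∃ q : ℕ, 0 < q ∧ (L.map ini).prod ^ q * F ∈ Ideal.span {T | T ∈ L}}

/-- A regular set: a triangular set such that `res(ini(T_j), [T_1, …, T_{j-1}]) ≠ 0`
for `j = 2, …, r`. -/
def RegularSet (L : List (MvPolynomial (Fin n) K)) : Prop :=
  TriangularSet L ∧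
    ∀ j : ℕ, 0 < j → j < L.length → resTS (ini (L.getD j 0)) (L.take j) ≠ 0

/-- A normal triangular set: `deg(ini(T_j), lv(T_i)) = 0` for all `i < j`. -/
def NormalSet (L : List (MvPolynomial (Fin n) K)) : Prop :=
  TriangularSet L ∧ L.Pairwise fun A B => degLv (ini B) A = 0

/-- The purely lexicographical order on monomials determined by `x_1 < ⋯ < x_n`. -/
def plexLT (a b : Fin n →₀ ℕ) : Prop :=
  ∃ k : Fin n, a k < b k ∧ ∀ j : Fin n, k < j → a j = b j

/-- `m` is the leading monomial of `P` w.r.t. the plex order. -/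
def IsLpp (P : MvPolynomial (Fin n) K) (m : Fin n →₀ ℕ) : Prop :=
  m ∈ P.support ∧ ∀ m' ∈ P.support, m' ≠ m → plexLT m' m

/-- `G` is the reduced (Buchberger–)Gröbner basis of the ideal `I` w.r.t. the plex
term order determined by `x_1 < ⋯ < x_n`: its elements are nonzero monic members of `I`,
the leading monomial of every nonzero member of `I` is divisible by the leading monomial
of some element of `G`, every element of `G` is B-reduced w.r.t. the others, and `G`
generates `I`. -/
def IsReducedGB (I : Ideal (MvPolynomial (Fin n) K)) (G : Finset (MvPolynomial (Fin n) K)) :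
    Prop :=
  (∀ g ∈ G, g ∈ I ∧ g ≠ 0 ∧ ∀ m, IsLpp g m → g.coeff m = 1) ∧
    (∀ F ∈ I, F ≠ 0 → ∃ g ∈ G, ∃ mg mF, IsLpp g mg ∧ IsLpp F mF ∧ mg ≤ mF) ∧
    (∀ g ∈ G, ∀ g' ∈ G, g' ≠ g → ∀ m ∈ g.support, ∀ m', IsLpp g' m' → ¬ m' ≤ m) ∧
    Ideal.span (G : Set (MvPolynomial (Fin n) K)) = I

/-- `Cs` is the W-characteristic set of `I`: the minimal triangular set contained in the
reduced plex Gröbner basis `G` of `I`, i.e. for each class realized in `G`, `Cs` contains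
the element of that class whose leading monomial is minimal w.r.t. the plex order, the
elements being ordered by increasing class (equivalently, by the plex order). -/
def IsWCharSet (I : Ideal (MvPolynomial (Fin n) K)) (Cs : List (MvPolynomial (Fin n) K)) :
    Prop :=
  ∃ G : Finset (MvPolynomial (Fin n) K), IsReducedGB I G ∧
    (Cs.Chain' fun A B => cls A < cls B) ∧
    (∀ c ∈ Cs, c ∈ G) ∧
    (∀ g ∈ G, ∃ c ∈ Cs, cls c = cls g) ∧
    ∀ c ∈ Cs, ∀ g ∈ G, cls g = cls c → g ≠ c →
      ∃ mc mg, IsLpp c mc ∧ IsLpp g mg ∧ plexLT mc mg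

/-- The set of common zeros of a set `S` of polynomials over `k`, taken in `Kc ^ n`
for an extension `Kc` of `k`. -/
def zeroSet {k : Type*} [Field k] (Kc : Type*) [CommRing Kc] [Algebra k Kc]
    (S : Set (MvPolynomial (Fin n) k)) : Set (Fin n → Kc) :=
  {a | ∀ p ∈ S, MvPolynomial.aeval a p = 0}


theorem coeff_coefv (i : Fin n) (d : ℕ) (F : MvPolynomial (Fin n) K) (m : Fin n →₀ ℕ) :
    (coefv i d F).coeff m = if m i = 0 then F.coeff (m + Finsupp.single i d) else 0 := by
  classical
  have key : ∀ μ : Fin n →₀ ℕ, (μ i = d ∧ Finsupp.erase i μ = m) ↔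
      (m i = 0 ∧ μ = m + Finsupp.single i d) := by
    intro μ
    constructor
    · rintro ⟨rfl, rfl⟩
      refine ⟨Finsupp.erase_same, ?_⟩
      rw [add_comm, Finsupp.single_add_erase]
    · rintro ⟨h, rfl⟩
      refine ⟨by simp [h], ?_⟩
      ext j
      rcases eq_or_ne j i with rfl | hj
      · simp [h]
      · simp [Finsupp.erase_ne hj]
  simp only [coefv, coeff_sum, coeff_monomial]
  rw [← Finset.sum_filter, Finset.filter_filter]
  simp only [key]
  split_ifs with h
  · rw [Finset.sum_eq_single (m + Finsupp.single i d)]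
    · intro b hb hne
      simp only [Finset.mem_filter] at hb
      exact absurd hb.2.2 hne
    · intro hb
      by_contra h2
      exact hb (by simp [h, mem_support_iff, h2])
  · rw [Finset.filter_false_of_mem, Finset.sum_empty]
    exact fun _ _ h' => h h'.1

theorem coefv_add (i : Fin n) (d : ℕ) (F G : MvPolynomial (Fin n) K) :
    coefv i d (F + G) = coefv i d F + coefv i d G := by
  ext m
  simp only [coeff_coefv, coeff_add]
  split_ifs <;> simp

theorem coefv_sub (i : Fin n) (d : ℕ) (F G : MvPolynomial (Fin n) K) :
    coefv i d (F - G) = coefv i d F - coefv i d G := by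
  ext m
  simp only [coeff_coefv, coeff_sub]
  split_ifs <;> simp

theorem coefv_zero (i : Fin n) (d : ℕ) : coefv i d (0 : MvPolynomial (Fin n) K) = 0 := by
  ext m
  simp [coeff_coefv]

theorem coefv_sum {ι : Type*} (i : Fin n) (d : ℕ) (s : Finset ι)
    (f : ι → MvPolynomial (Fin n) K) :
    coefv i d (∑ j ∈ s, f j) = ∑ j ∈ s, coefv i d (f j) := by
  classical
  induction s using Finset.induction_on with
  | empty => simp [coefv_zero]
  | insert a s ha ih => rw [Finset.sum_insert ha, Finset.sum_insert ha, coefv_add, ih]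

theorem coefv_mul_monomial (i : Fin n) (d : ℕ) (F : MvPolynomial (Fin n) K) (s : Fin n →₀ ℕ)
    (hs : s i = 0) (a : K) :
    coefv i d (F * monomial s a) = coefv i d F * monomial s a := by
  ext m
  have hle : s ≤ m + Finsupp.single i d ↔ s ≤ m := by
    refine ⟨fun h j => ?_, fun h => h.trans le_self_add⟩
    rcases eq_or_ne j i with rfl | hj
    · simp [hs]
    · simpa [Finsupp.single_eq_of_ne hj] using h j
  simp only [coeff_coefv, coeff_mul_monomial', hle]
  by_cases h : s ≤ m
  · rw [tsub_add_eq_add_tsub h]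
    simp [h, hs]
  · simp [h]

/-- Taking coefficients in `x_i` commutes with multiplication by a polynomial free of `x_i`. -/
theorem coefv_mul_of_degreeOf_eq_zero (i : Fin n) (d : ℕ) (F : MvPolynomial (Fin n) K)
    {S : MvPolynomial (Fin n) K} (hS : S.degreeOf i = 0) :
    coefv i d (F * S) = coefv i d F * S := by
  conv_lhs => rw [S.as_sum]
  conv_rhs => rw [S.as_sum]
  rw [Finset.mul_sum, coefv_sum, Finset.mul_sum]
  refine Finset.sum_congr rfl fun s hs => coefv_mul_monomial i d F s ?_ _
  exact Nat.le_zero.mp (hS ▸ monomial_le_degreeOf i hs)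

theorem coefv_mul_X_pow (i : Fin n) (d e : ℕ) (F : MvPolynomial (Fin n) K) :
    coefv i (d + e) (F * X i ^ e) = coefv i d F := by
  ext m
  rw [coeff_coefv, coeff_coefv, X_pow_eq_monomial, Finsupp.single_add, ← add_assoc,
    coeff_mul_monomial, mul_one]

theorem degreeOf_coefv_self (i : Fin n) (d : ℕ) (F : MvPolynomial (Fin n) K) :
    (coefv i d F).degreeOf i = 0 := by
  refine Nat.le_zero.mp (degreeOf_le_iff.mpr fun m hm => ?_)
  by_contra h
  rw [mem_support_iff, coeff_coefv, if_neg (by omega)] at hm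
  exact hm rfl

theorem add_single_mem_support {i : Fin n} {d : ℕ} {F : MvPolynomial (Fin n) K}
    {m : Fin n →₀ ℕ} (hm : m ∈ (coefv i d F).support) :
    m i = 0 ∧ m + Finsupp.single i d ∈ F.support := by
  rw [mem_support_iff, coeff_coefv] at hm
  split_ifs at hm with h
  · exact ⟨h, mem_support_iff.mpr hm⟩
  · exact absurd rfl hm

theorem erase_mem_support_coefv {i : Fin n} {F : MvPolynomial (Fin n) K}
    {m : Fin n →₀ ℕ} (hm : m ∈ F.support) : m.erase i ∈ (coefv i (m i) F).support := by
  rw [mem_support_iff, coeff_coefv, if_pos Finsupp.erase_same, add_comm,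
    Finsupp.single_add_erase]
  exact mem_support_iff.mp hm

theorem degreeOf_coefv_le (i j : Fin n) (d : ℕ) (F : MvPolynomial (Fin n) K) :
    (coefv i d F).degreeOf j ≤ F.degreeOf j := by
  refine degreeOf_le_iff.mpr fun m hm => ?_
  exact le_trans (by simp) (monomial_le_degreeOf j (add_single_mem_support hm).2)

theorem exists_mem_support_eq_degreeOf (i : Fin n) {F : MvPolynomial (Fin n) K} (hF : F ≠ 0) :
    ∃ m ∈ F.support, m i = F.degreeOf i := by
  rw [degreeOf_eq_sup]
  obtain ⟨m, hm, h⟩ := Finset.exists_mem_eq_sup F.support (support_nonempty.mpr hF) fun m => m i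
  exact ⟨m, hm, h.symm⟩

theorem lcv_ne_zero (i : Fin n) {F : MvPolynomial (Fin n) K} (hF : F ≠ 0) : lcv i F ≠ 0 := by
  obtain ⟨m, hm, h⟩ := exists_mem_support_eq_degreeOf i hF
  have := erase_mem_support_coefv (i := i) hm
  rw [h] at this
  exact ne_zero_iff.mpr ⟨_, mem_support_iff.mp this⟩

theorem degreeOf_lt_of_coefv_eq_zero {i : Fin n} {d : ℕ} {F : MvPolynomial (Fin n) K}
    (hd : 0 < d) (hle : F.degreeOf i ≤ d) (h0 : coefv i d F = 0) : F.degreeOf i < d := by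
  refine (degreeOf_lt_iff hd).mpr fun m hm => ?_
  refine lt_of_le_of_ne (degreeOf_le_iff.mp hle m hm) ?_
  rintro rfl
  simpa [h0] using erase_mem_support_coefv (i := i) hm

theorem degreeOf_mul_eq_zero {j : Fin n} {F G : MvPolynomial (Fin n) K}
    (hF : F.degreeOf j = 0) (hG : G.degreeOf j = 0) : (F * G).degreeOf j = 0 :=
  Nat.le_zero.mp ((degreeOf_mul_le j F G).trans (by omega))

theorem degreeOf_pow_eq_zero {j : Fin n} {F : MvPolynomial (Fin n) K}
    (hF : F.degreeOf j = 0) (q : ℕ) : (F ^ q).degreeOf j = 0 :=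
  Nat.le_zero.mp ((degreeOf_pow_le j F q).trans (by simp [hF]))

theorem pdivAux_spec (i : Fin n) (F : MvPolynomial (Fin n) K) (q : ℕ)
    (QR : MvPolynomial (Fin n) K × MvPolynomial (Fin n) K) :
    (pdivAux i F q QR).1 * F + (pdivAux i F q QR).2 = lcv i F ^ q * (QR.1 * F + QR.2) := by
  induction q generalizing QR with
  | zero => simp [pdivAux]
  | succ q ih =>
    rw [pdivAux]
    split_ifs with h
    · ring
    · rw [ih]
      ring

theorem degreeOf_pdivAux_lt (i : Fin n) (F : MvPolynomial (Fin n) K) (hF : 0 < F.degreeOf i)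
    (q : ℕ) (QR : MvPolynomial (Fin n) K × MvPolynomial (Fin n) K)
    (hq : QR.2.degreeOf i < F.degreeOf i + q) :
    (pdivAux i F q QR).2.degreeOf i < F.degreeOf i := by
  have hlc : (lcv i F).degreeOf i = 0 := degreeOf_coefv_self i _ F
  induction q generalizing QR with
  | zero => simpa [pdivAux] using hq
  | succ q ih =>
    rw [pdivAux]
    split_ifs with h
    · refine lt_of_le_of_lt (degreeOf_mul_le _ _ _) ?_
      rw [degreeOf_pow_eq_zero hlc]
      omega
    · refine ih _ (lt_of_lt_of_le ?_ (Nat.lt_succ_iff.mp hq))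
      obtain ⟨Q, R⟩ := QR
      simp only at h hq ⊢
      have hc : (coefv i (R.degreeOf i) R).degreeOf i = 0 := degreeOf_coefv_self i _ R
      refine degreeOf_lt_of_coefv_eq_zero (by omega) ?_ ?_
      · refine (degreeOf_sub_le _ _ _).trans (max_le ?_ ?_)
        · refine (degreeOf_mul_le _ _ _).trans ?_
          omega
        · refine (degreeOf_mul_le _ _ _).trans ?_
          have h1 := degreeOf_mul_le i (coefv i (R.degreeOf i) R)
            (X i ^ (R.degreeOf i - F.degreeOf i))
          rw [degreeOf_X_self_pow] at h1
          omega
      · have hX := coefv_mul_X_pow i (F.degreeOf i) (R.degreeOf i - F.degreeOf i) F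
        rw [Nat.add_sub_cancel' (not_lt.mp h)] at hX
        rw [coefv_sub, mul_comm (lcv i F) R, coefv_mul_of_degreeOf_eq_zero i _ R hlc,
          mul_assoc, mul_comm (coefv i (R.degreeOf i) R) (_ * F),
          coefv_mul_of_degreeOf_eq_zero i _ _ hc, mul_comm _ F, hX, lcv, mul_comm, sub_self]

theorem degreeOf_pdivAux_snd_le {i j : Fin n} (hij : j ≠ i) {F : MvPolynomial (Fin n) K}
    (hF : F.degreeOf j = 0) (q : ℕ) (QR : MvPolynomial (Fin n) K × MvPolynomial (Fin n) K) :
    (pdivAux i F q QR).2.degreeOf j ≤ QR.2.degreeOf j := by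
  have hlc : (lcv i F).degreeOf j = 0 := Nat.le_zero.mp (hF ▸ degreeOf_coefv_le i j _ F)
  induction q generalizing QR with
  | zero => simp [pdivAux]
  | succ q ih =>
    rw [pdivAux]
    split_ifs with h
    · refine (degreeOf_mul_le _ _ _).trans ?_
      rw [degreeOf_pow_eq_zero hlc, zero_add]
    · refine (ih _).trans ((degreeOf_sub_le _ _ _).trans (max_le ?_ ?_))
      · refine (degreeOf_mul_le _ _ _).trans ?_
        rw [hlc, zero_add]
      · refine (degreeOf_mul_le _ _ _).trans ?_
        rw [hF, add_zero]
        refine (degreeOf_mul_le _ _ _).trans ?_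
        rw [degreeOf_X_pow_of_ne _ hij, add_zero]
        exact degreeOf_coefv_le _ _ _ _

theorem degreeOf_pdivAux_fst {i j : Fin n} (hij : j ≠ i) {F : MvPolynomial (Fin n) K}
    (hF : F.degreeOf j = 0) (q : ℕ) (QR : MvPolynomial (Fin n) K × MvPolynomial (Fin n) K)
    (h1 : QR.1.degreeOf j = 0) (h2 : QR.2.degreeOf j = 0) :
    (pdivAux i F q QR).1.degreeOf j = 0 := by
  have hlc : (lcv i F).degreeOf j = 0 := Nat.le_zero.mp (hF ▸ degreeOf_coefv_le i j _ F)
  induction q generalizing QR with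
  | zero => simpa [pdivAux] using h1
  | succ q ih =>
    rw [pdivAux]
    split_ifs with h
    · exact degreeOf_mul_eq_zero (degreeOf_pow_eq_zero hlc _) h1
    · have hc : (coefv i (QR.2.degreeOf i) QR.2 *
          X i ^ (QR.2.degreeOf i - F.degreeOf i)).degreeOf j = 0 :=
        degreeOf_mul_eq_zero (Nat.le_zero.mp (h2 ▸ degreeOf_coefv_le _ _ _ _))
          (degreeOf_X_pow_of_ne _ hij)
      refine ih _ ?_ ?_
      · refine Nat.le_zero.mp ((degreeOf_add_le _ _ _).trans ?_)
        rw [degreeOf_mul_eq_zero hlc h1, hc, max_self]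
      · refine Nat.le_zero.mp ((degreeOf_sub_le _ _ _).trans ?_)
        rw [degreeOf_mul_eq_zero hlc h2, degreeOf_mul_eq_zero hc hF, max_self]

theorem pquo_mul_add_prem (G F : MvPolynomial (Fin n) K) (i : Fin n) :
    pquo G F i * F + prem G F i = lcv i F ^ (G.degreeOf i + 1 - F.degreeOf i) * G := by
  rw [pquo, prem, pdivAux_spec, zero_mul, zero_add]

theorem degreeOf_prem_lt (G : MvPolynomial (Fin n) K) {F : MvPolynomial (Fin n) K} {i : Fin n}
    (hF : 0 < F.degreeOf i) : (prem G F i).degreeOf i < F.degreeOf i :=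
  degreeOf_pdivAux_lt i F hF _ _ (by simp only; omega)

theorem degreeOf_prem_le (G : MvPolynomial (Fin n) K) {F : MvPolynomial (Fin n) K} {i j : Fin n}
    (hij : j ≠ i) (hF : F.degreeOf j = 0) : (prem G F i).degreeOf j ≤ G.degreeOf j :=
  degreeOf_pdivAux_snd_le hij hF _ _

theorem degreeOf_pquo {G F : MvPolynomial (Fin n) K} {i j : Fin n}
    (hij : j ≠ i) (hG : G.degreeOf j = 0) (hF : F.degreeOf j = 0) :
    (pquo G F i).degreeOf j = 0 :=
  degreeOf_pdivAux_fst hij hF _ _ (degreeOf_zero j) hG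

theorem max'_vars_of_cls {P : MvPolynomial (Fin n) K} {y : Fin n} (h : cls P = (y : ℕ) + 1) :
    ∃ hP : P.vars.Nonempty, P.vars.max' hP = y := by
  have hP : P.vars.Nonempty := by
    by_contra hP
    simp [cls, Finset.not_nonempty_iff_eq_empty.mp hP] at h
  refine ⟨hP, ?_⟩
  obtain ⟨b, hb, hbe⟩ := Finset.exists_mem_eq_sup P.vars hP fun i => (i : ℕ) + 1
  have hby : b = y := Fin.ext (by simp only [cls] at h; omega)
  subst hby
  refine le_antisymm (Finset.max'_le _ _ _ fun j hj => ?_) (Finset.le_max' _ _ hb)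
  have hle : (j : ℕ) + 1 ≤ P.vars.sup fun i => (i : ℕ) + 1 :=
    Finset.le_sup (f := fun i : Fin n => (i : ℕ) + 1) hj
  rw [Fin.le_def]
  omega

theorem degreeOf_pos_of_cls {P : MvPolynomial (Fin n) K} {y : Fin n}
    (h : cls P = (y : ℕ) + 1) : 0 < P.degreeOf y := by
  obtain ⟨hP, rfl⟩ := max'_vars_of_cls h
  exact Nat.pos_of_ne_zero (mem_vars_iff_degreeOf_ne_zero.mp (Finset.max'_mem _ hP))

theorem degreeOf_eq_zero_of_cls {P : MvPolynomial (Fin n) K} {y j : Fin n}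
    (h : cls P = (y : ℕ) + 1) (hj : y < j) : P.degreeOf j = 0 := by
  obtain ⟨hP, rfl⟩ := max'_vars_of_cls h
  by_contra h0
  exact absurd (Finset.le_max' _ _ (mem_vars_iff_degreeOf_ne_zero.mpr h0)) (not_le.mpr hj)

theorem ne_zero_of_cls {P : MvPolynomial (Fin n) K} {y : Fin n}
    (h : cls P = (y : ℕ) + 1) : P ≠ 0 := by
  rintro rfl
  simpa using degreeOf_pos_of_cls h

theorem ini_eq_lcv {P : MvPolynomial (Fin n) K} {y : Fin n}
    (h : cls P = (y : ℕ) + 1) : ini P = lcv y P := by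
  obtain ⟨hP, rfl⟩ := max'_vars_of_cls h
  rw [ini, dif_pos hP]

theorem degLv_eq_degreeOf (G : MvPolynomial (Fin n) K) {P : MvPolynomial (Fin n) K} {y : Fin n}
    (h : cls P = (y : ℕ) + 1) : degLv G P = G.degreeOf y := by
  obtain ⟨hP, rfl⟩ := max'_vars_of_cls h
  rw [degLv, dif_pos hP]

theorem premLv_eq_prem (G : MvPolynomial (Fin n) K) {P : MvPolynomial (Fin n) K} {y : Fin n}
    (h : cls P = (y : ℕ) + 1) : premLv G P = prem G P y := by
  obtain ⟨hP, rfl⟩ := max'_vars_of_cls h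
  rw [premLv, dif_pos hP]

theorem pquoLv_eq_pquo (G : MvPolynomial (Fin n) K) {P : MvPolynomial (Fin n) K} {y : Fin n}
    (h : cls P = (y : ℕ) + 1) : pquoLv G P = pquo G P y := by
  obtain ⟨hP, rfl⟩ := max'_vars_of_cls h
  rw [pquoLv, dif_pos hP]

theorem plexLT.asymm {a b : Fin n →₀ ℕ} (h : plexLT a b) : ¬ plexLT b a := by
  rintro ⟨k', h1', h2'⟩
  obtain ⟨k, h1, h2⟩ := h
  rcases lt_trichotomy k k' with hk | rfl | hk
  · have := h2 _ hk
    omega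
  · omega
  · have := h2' _ hk
    omega

theorem IsLpp.unique {P : MvPolynomial (Fin n) K} {a b : Fin n →₀ ℕ} (ha : IsLpp P a)
    (hb : IsLpp P b) : a = b := by
  by_contra h
  exact (ha.2 b hb.1 (Ne.symm h)).asymm (hb.2 a ha.1 h)

theorem apply_le_of_plexLT {a b : Fin n →₀ ℕ} (h : a = b ∨ plexLT a b) {i : Fin n}
    (hi : ∀ j, i < j → b j ≤ a j) : a i ≤ b i := by
  rcases h with rfl | ⟨k, h1, h2⟩
  · exact le_rfl
  · rcases lt_trichotomy i k with hk | rfl | hk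
    · have := hi k hk
      omega
    · exact h1.le
    · exact (h2 i hk).le

theorem IsLpp.eq_or_plexLT {P : MvPolynomial (Fin n) K} {a b : Fin n →₀ ℕ} (ha : IsLpp P a)
    (hb : b ∈ P.support) : b = a ∨ plexLT b a :=
  or_iff_not_imp_left.mpr (ha.2 b hb)

theorem IsLpp.apply_eq_zero_of_cls {P : MvPolynomial (Fin n) K} {y j : Fin n} {m : Fin n →₀ ℕ}
    (h : cls P = (y : ℕ) + 1) (hm : IsLpp P m) (hj : y < j) : m j = 0 :=
  Nat.le_zero.mp (degreeOf_eq_zero_of_cls h hj ▸ monomial_le_degreeOf j hm.1)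

theorem IsLpp.apply_of_cls {P : MvPolynomial (Fin n) K} {y : Fin n} {m : Fin n →₀ ℕ}
    (h : cls P = (y : ℕ) + 1) (hm : IsLpp P m) : m y = P.degreeOf y := by
  refine le_antisymm (monomial_le_degreeOf y hm.1) ?_
  obtain ⟨μ, hμ, hμy⟩ := exists_mem_support_eq_degreeOf y (ne_zero_of_cls h)
  rw [← hμy]
  refine apply_le_of_plexLT (hm.eq_or_plexLT hμ) fun j hj => ?_
  rw [hm.apply_eq_zero_of_cls h hj]
  exact Nat.zero_le _

/-- The leading monomial of a nonzero member of the ideal is divisible by a monomial which is at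
least the leading monomial of some element of the W-characteristic set in the plex order and
has at least its degree in the corresponding leading variable. -/
theorem IsWCharSet.exists_lpp {I : Ideal (MvPolynomial (Fin n) K)}
    {Cs : List (MvPolynomial (Fin n) K)} (hW : IsWCharSet I Cs) {y : ℕ → Fin n}
    (hy : ∀ i < Cs.length, cls (Cs.getD i 0) = (y i : ℕ) + 1)
    {F : MvPolynomial (Fin n) K} (hF : F ∈ I) (hF0 : F ≠ 0) :
    ∃ i < Cs.length, ∃ mc mg mF, IsLpp (Cs.getD i 0) mc ∧ IsLpp F mF ∧ mg ≤ mF ∧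
      (mc = mg ∨ plexLT mc mg) ∧ (Cs.getD i 0).degreeOf (y i) ≤ mg (y i) := by
  obtain ⟨G, ⟨-, hG, -, -⟩, -, -, hGC, hmin⟩ := hW
  obtain ⟨g, hg, mg, mF, hmg, hmF, hle⟩ := hG F hF hF0
  obtain ⟨c, hc, hcg⟩ := hGC g hg
  obtain ⟨i, hi, rfl⟩ := List.mem_iff_getElem.mp hc
  have hci : Cs[i] = Cs.getD i 0 := by simp [hi]
  rw [hci] at hc hcg
  have hcl := hy i hi
  have hcmp : ∃ mc, IsLpp (Cs.getD i 0) mc ∧ (mc = mg ∨ plexLT mc mg) := by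
    by_cases hgc : g = Cs.getD i 0
    · exact ⟨mg, hgc ▸ hmg, Or.inl rfl⟩
    · obtain ⟨mc, mg', h1, h2, h3⟩ := hmin _ hc g hg hcg.symm hgc
      exact ⟨mc, h1, Or.inr (hmg.unique h2 ▸ h3)⟩
  obtain ⟨mc, hmc, hlt⟩ := hcmp
  refine ⟨i, hi, mc, mg, mF, hmc, hmF, hle, hlt, ?_⟩
  rw [← hmc.apply_of_cls hcl]
  refine apply_le_of_plexLT hlt fun j hj => ?_
  rw [hmg.apply_eq_zero_of_cls (hcg ▸ hcl) hj]
  exact Nat.zero_le _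

theorem IsWCharSet.eq_zero_of_reduced {I : Ideal (MvPolynomial (Fin n) K)}
    {Cs : List (MvPolynomial (Fin n) K)} (hW : IsWCharSet I Cs) {y : ℕ → Fin n}
    (hy : ∀ i < Cs.length, cls (Cs.getD i 0) = (y i : ℕ) + 1)
    {F : MvPolynomial (Fin n) K} (hF : F ∈ I)
    (hred : ∀ i < Cs.length, F.degreeOf (y i) < (Cs.getD i 0).degreeOf (y i)) : F = 0 := by
  by_contra hF0
  obtain ⟨i, hi, mc, mg, mF, -, hmF, hle, -, hd⟩ := hW.exists_lpp hy hF hF0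
  have h1 := monomial_le_degreeOf (y i) hmF.1
  have h2 := hle (y i)
  have h3 := hred i hi
  omega

theorem IsWCharSet.getD_mem {I : Ideal (MvPolynomial (Fin n) K)}
    {Cs : List (MvPolynomial (Fin n) K)} (hW : IsWCharSet I Cs) {i : ℕ} (hi : i < Cs.length) :
    Cs.getD i 0 ∈ I := by
  obtain ⟨G, hG, -, hC, -⟩ := hW
  have : Cs.getD i 0 ∈ Cs := by simp [hi]
  exact (hG.1 _ (hC _ this)).1

theorem coefv_mem_span {S : Set (MvPolynomial (Fin n) K)} {i : Fin n} (d : ℕ)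
    (hS : ∀ s ∈ S, s.degreeOf i = 0) {F : MvPolynomial (Fin n) K} (hF : F ∈ Ideal.span S) :
    coefv i d F ∈ Ideal.span S := by
  suffices h : ∀ a, coefv i d (a * F) ∈ Ideal.span S by simpa using h 1
  induction hF using Submodule.span_induction with
  | mem x hx =>
    intro a
    rw [coefv_mul_of_degreeOf_eq_zero i d a (hS x hx)]
    exact Ideal.mul_mem_left _ _ (Ideal.subset_span hx)
  | zero => simp [coefv_zero]
  | add x z _ _ hx hz =>
    intro a
    rw [mul_add, coefv_add]
    exact add_mem (hx a) (hz a)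
  | smul b x _ hx =>
    intro a
    rw [smul_eq_mul, ← mul_assoc]
    exact hx _

theorem cls_le (P : MvPolynomial (Fin n) K) : cls P ≤ n :=
  Finset.sup_le fun i _ => i.isLt

/-- Iterated pseudo-division by an initial segment of a triangular set whose initials are free of
the variables satisfying `p`. -/
theorem premTS_take_spec {Cs : List (MvPolynomial (Fin n) K)} {y : ℕ → Fin n}
    (hy : ∀ i < Cs.length, cls (Cs.getD i 0) = (y i : ℕ) + 1)
    (hmono : ∀ i j, i < j → j < Cs.length → y i < y j) (p : Fin n → Prop) {t : ℕ}
    (ht : t ≤ Cs.length) (hp : ∀ i < t, ∀ j, p j → (ini (Cs.getD i 0)).degreeOf j = 0)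
    (F : MvPolynomial (Fin n) K) :
    (∃ h : MvPolynomial (Fin n) K, h ≠ 0 ∧ (∀ j, p j → h.degreeOf j = 0) ∧
      h * F - premTS F (Cs.take t) ∈ Ideal.span ((fun i => Cs.getD i 0) '' Set.Iio t)) ∧
    (∀ i < t, (premTS F (Cs.take t)).degreeOf (y i) < (Cs.getD i 0).degreeOf (y i)) ∧
    ∀ j, (∀ i < t, y i < j) → (premTS F (Cs.take t)).degreeOf j ≤ F.degreeOf j := by
  induction t generalizing F with
  | zero =>
    refine ⟨⟨1, one_ne_zero, fun j _ => degreeOf_one j, ?_⟩, ?_, ?_⟩ <;> simp [premTS]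
  | succ t ih =>
    have ht' : t < Cs.length := ht
    have hcls := hy t ht'
    have hstep : premTS F (Cs.take (t + 1)) =
        premTS (prem F (Cs.getD t 0) (y t)) (Cs.take t) := by
      rw [List.take_succ_eq_append_getElem ht', premTS, List.foldr_append, premTS]
      have : Cs[t] = Cs.getD t 0 := by simp [ht']
      rw [this, List.foldr_cons, List.foldr_nil, premLv_eq_prem _ hcls]
    obtain ⟨⟨h, h0, hhp, hmem⟩, hlt, hle⟩ := ih ht'.le (fun i hi => hp i (by omega))
      (prem F (Cs.getD t 0) (y t))
    rw [hstep]
    refine ⟨⟨h * lcv (y t) (Cs.getD t 0) ^ (F.degreeOf (y t) + 1 -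
      (Cs.getD t 0).degreeOf (y t)), ?_, ?_, ?_⟩, ?_, ?_⟩
    · exact mul_ne_zero h0 (pow_ne_zero _ (lcv_ne_zero _ (ne_zero_of_cls hcls)))
    · intro j hj
      refine degreeOf_mul_eq_zero (hhp j hj) (degreeOf_pow_eq_zero ?_ _)
      rw [← ini_eq_lcv hcls]
      exact hp t (by omega) j hj
    · rw [mul_assoc, ← pquo_mul_add_prem, mul_add, add_sub_assoc, ← mul_assoc]
      refine add_mem (Ideal.mul_mem_left _ _ (Ideal.subset_span ⟨t, by simp, rfl⟩)) ?_
      exact Ideal.span_mono (Set.image_mono (Set.Iio_subset_Iio (by omega))) hmem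
    · intro i hi
      rcases Nat.lt_succ_iff_lt_or_eq.mp hi with hi | rfl
      · exact hlt i hi
      · exact (hle _ fun j hj => hmono j i hj ht').trans_lt
          (degreeOf_prem_lt F (degreeOf_pos_of_cls hcls))
    · intro j hj
      refine (hle j fun i hi => hj i (by omega)).trans ?_
      have := hj t (by omega)
      exact degreeOf_prem_le F this.ne' (degreeOf_eq_zero_of_cls hcls this)

/-- A member of the ideal, reduced with respect to the elements preceding `Cs.getD k 0` and of
degree at most that of `Cs.getD k 0` in its leading variable, vanishes as soon as its leading
coefficient in that variable has lower degree than the initial of `Cs.getD k 0`. -/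
theorem IsWCharSet.eq_zero_of_coefv {I : Ideal (MvPolynomial (Fin n) K)}
    {Cs : List (MvPolynomial (Fin n) K)} (hW : IsWCharSet I Cs) {y : ℕ → Fin n}
    (hy : ∀ i < Cs.length, cls (Cs.getD i 0) = (y i : ℕ) + 1)
    (hmono : ∀ i j, i < j → j < Cs.length → y i < y j) {k : ℕ} (hk : k < Cs.length) {z : Fin n}
    (hz : cls (ini (Cs.getD k 0)) = (z : ℕ) + 1)
    {F : MvPolynomial (Fin n) K} (hF : F ∈ I)
    (hred : ∀ i < k, F.degreeOf (y i) < (Cs.getD i 0).degreeOf (y i))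
    (hdeg : F.degreeOf (y k) ≤ (Cs.getD k 0).degreeOf (y k))
    (hgt : ∀ j, y k < j → F.degreeOf j = 0)
    (hco : (coefv (y k) ((Cs.getD k 0).degreeOf (y k)) F).degreeOf z <
      (ini (Cs.getD k 0)).degreeOf z)
    (hco' : ∀ j, z < j → (coefv (y k) ((Cs.getD k 0).degreeOf (y k)) F).degreeOf j = 0) :
    F = 0 := by
  by_contra hF0
  obtain ⟨i, hi, mc, mg, mF, hmc, hmF, hle, hlt, hd⟩ := hW.exists_lpp hy hF hF0
  have hFle := fun j => monomial_le_degreeOf j hmF.1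
  obtain rfl : i = k := by
    have h1 := hFle (y i)
    have h2 := hle (y i)
    rcases lt_trichotomy i k with h | h | h
    · have := hred i h
      omega
    · exact h
    · have := hgt _ (hmono k i h hi)
      have := degreeOf_pos_of_cls (hy i hi)
      omega
  have hcls := hy i hi
  have hmFy : mF (y i) = (Cs.getD i 0).degreeOf (y i) :=
    le_antisymm ((hFle _).trans hdeg) (hd.trans (hle _))
  have hmcy := hmc.apply_of_cls hcls
  rw [ini_eq_lcv hcls, lcv] at hz hco
  have hzy : z ≠ y i := by
    rintro rfl
    exact (degreeOf_pos_of_cls hz).ne' (degreeOf_coefv_self _ _ _)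
  have hmFsupp := erase_mem_support_coefv (i := y i) hmF.1
  rw [hmFy] at hmFsupp
  have hmcsupp := erase_mem_support_coefv (i := y i) hmc.1
  rw [hmcy] at hmcsupp
  have hmFz : mF z < (coefv (y i) ((Cs.getD i 0).degreeOf (y i)) (Cs.getD i 0)).degreeOf z := by
    have := monomial_le_degreeOf z hmFsupp
    rw [Finsupp.erase_ne hzy] at this
    omega
  have hmFj : ∀ j, z < j → j ≠ y i → mF j = 0 := fun j hj hji => by
    have := monomial_le_degreeOf j hmFsupp
    rw [Finsupp.erase_ne hji, hco' j hj] at this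
    omega
  have hmcj : ∀ j, z < j → j ≠ y i → mc j = 0 := fun j hj hji => by
    have := monomial_le_degreeOf j hmcsupp
    rw [Finsupp.erase_ne hji, degreeOf_eq_zero_of_cls hz hj] at this
    omega
  obtain ⟨μ, hμ, hμz⟩ := exists_mem_support_eq_degreeOf z (ne_zero_of_cls hz)
  obtain ⟨hμy, hμ⟩ := add_single_mem_support hμ
  have h1 : μ z ≤ mc z := by
    have := apply_le_of_plexLT (i := z) (hmc.eq_or_plexLT hμ) fun j hj => by
      rcases eq_or_ne j (y i) with rfl | hji
      · simp [hμy, hmcy]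
      · simp [hmcj j hj hji]
    simpa [Finsupp.single_eq_of_ne hzy] using this
  have h2 : mc z ≤ mg z := apply_le_of_plexLT hlt fun j hj => by
    rcases eq_or_ne j (y i) with rfl | hji
    · exact (hle _).trans (by rw [hmFy, hmcy])
    · exact (hle _).trans (by simp [hmFj j hj hji])
  have h3 := hle z
  omega

theorem degreeOf_le_of_mul_add_mul_eq_zero {a b A B : MvPolynomial (Fin n) K} {j : Fin n}
    (ha : a ≠ 0) (haj : a.degreeOf j = 0) (hbj : b.degreeOf j = 0)
    (h : a * A + b * B = 0) : A.degreeOf j ≤ B.degreeOf j := by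
  rcases eq_or_ne A 0 with rfl | hA
  · simp
  · have h1 := degreeOf_mul_eq (n := j) ha hA
    rw [eq_neg_of_add_eq_zero_left h, degreeOf_neg] at h1
    have := degreeOf_mul_le j b B
    omega

/-- Lemma mainlem (b). Let `[C_1, …, C_r]` be the W-characteristic set
of `⟨P⟩` under the variable ordering in which the leading variables of the `C_i` are the
`r` greatest variables, and let `k < r` be the biggest integer such that
`C_k = [C_1, …, C_k]` is normal. Let `I_{k+1} = ini(C_{k+1})`, `y_l = lv(I_{k+1})` and
`Q = pquo(C_l, I_{k+1}, y_l)`. If `I_{k+1}` is R-reduced with respect to `C_l`, then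
`prem(C_l, [C_1, …, C_{l−1}, I_{k+1}]) = 0` and `prem(Q·C_{k+1}, C_k) = 0`.
(0-based indexing: `C_{k+1} = Cs.getD k 0`, `C_l = Cs.getD l 0`,
`[C_1, …, C_{l−1}] = Cs.take l`.) -/
theorem statement15 {n : ℕ} {K : Type*} [Field K]
    (P : Finset (MvPolynomial (Fin n) K)) (hne : P.Nonempty) (h0 : ∀ p ∈ P, p ≠ 0)
    (hproper : Ideal.span (P : Set (MvPolynomial (Fin n) K)) ≠ ⊤)
    (Cs : List (MvPolynomial (Fin n) K))
    (hW : IsWCharSet (Ideal.span (P : Set (MvPolynomial (Fin n) K))) Cs)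
    (hord : ∀ i, i < Cs.length → cls (Cs.getD i 0) = n - Cs.length + i + 1)
    (k : ℕ) (hkr : k < Cs.length)
    (hnorm : NormalSet (Cs.take k))
    (hmax : ¬ NormalSet (Cs.take (k + 1)))
    (l : ℕ) (hl : l < Cs.length)
    (hlv : cls (ini (Cs.getD k 0)) = cls (Cs.getD l 0))
    (hred : RReduced (ini (Cs.getD k 0)) (Cs.getD l 0)) :
    premTS (Cs.getD l 0) (Cs.take l ++ [ini (Cs.getD k 0)]) = 0 ∧
      premTS (pquoLv (Cs.getD l 0) (ini (Cs.getD k 0)) * Cs.getD k 0) (Cs.take k) = 0 := by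
  set I := Ideal.span (P : Set (MvPolynomial (Fin n) K))
  have hrn : Cs.length ≤ n := by
    have h1 := hord (Cs.length - 1) (by omega)
    have h2 := cls_le (Cs.getD (Cs.length - 1) 0)
    omega
  obtain ⟨y, hyval⟩ : ∃ y : ℕ → Fin n, ∀ i < Cs.length, (y i : ℕ) = n - Cs.length + i :=
    ⟨fun i => ⟨min (n - Cs.length + i) (n - 1), by omega⟩, fun i hi => by simp only; omega⟩
  have hy : ∀ i < Cs.length, cls (Cs.getD i 0) = (y i : ℕ) + 1 := fun i hi => by
    rw [hord i hi, hyval i hi]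
  have hmono : ∀ i j, i < j → j < Cs.length → y i < y j := fun i j hij hj => by
    rw [Fin.lt_def, hyval i (by omega), hyval j hj]
    omega
  have hsurj : ∀ j : Fin n, n - Cs.length ≤ j → ∃ i < Cs.length, y i = j := fun j hj =>
    ⟨j - (n - Cs.length), by omega, Fin.ext (by rw [hyval _ (by omega)]; omega)⟩
  have hinideg : ∀ i < Cs.length, ∀ j, y i ≤ j → (ini (Cs.getD i 0)).degreeOf j = 0 := by
    intro i hi j hj
    rw [ini_eq_lcv (hy i hi), lcv]
    rcases hj.eq_or_lt with rfl | hj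
    · exact degreeOf_coefv_self _ _ _
    · exact Nat.le_zero.mp
        (degreeOf_eq_zero_of_cls (hy i hi) hj ▸ degreeOf_coefv_le _ _ _ _)
  have hfree : ∀ i < k, ∀ j : Fin n, n - Cs.length ≤ j →
      (ini (Cs.getD i 0)).degreeOf j = 0 := by
    intro i hi j hj
    obtain ⟨a, ha, rfl⟩ := hsurj j hj
    rcases le_or_gt i a with hia | hai
    · refine hinideg i (by omega) _ ?_
      rcases hia.eq_or_lt with rfl | hia
      · exact le_rfl
      · exact (hmono i a hia ha).le
    · have := List.pairwise_iff_getElem.mp hnorm.2 a i (by simp; omega) (by simp; omega) hai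
      rw [List.getElem_take, List.getElem_take] at this
      rw [← degLv_eq_degreeOf _ (hy a ha)]
      have e1 : Cs[i] = Cs.getD i 0 := by simp [hi.trans hkr]
      have e2 : Cs[a] = Cs.getD a 0 := by simp [ha]
      rwa [← e1, ← e2]
  have hz : cls (ini (Cs.getD k 0)) = (y l : ℕ) + 1 := hlv.trans (hy l hl)
  have hlk : l < k := by
    by_contra h
    have h1 := degreeOf_pos_of_cls hz
    rw [hinideg k hkr] at h1
    · exact absurd h1 (lt_irrefl _)
    · rcases (not_lt.mp h).eq_or_lt with h | h
      · rw [h]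
      · exact (hmono k l h hl).le
  rw [RReduced, degLv_eq_degreeOf _ (hy l hl), degLv_eq_degreeOf _ (hy l hl)] at hred
  rw [pquoLv_eq_pquo _ hz]
  have hpre : premTS (Cs.getD l 0) (Cs.take l ++ [ini (Cs.getD k 0)]) =
      premTS (prem (Cs.getD l 0) (ini (Cs.getD k 0)) (y l)) (Cs.take l) := by
    rw [premTS, List.foldr_append, premTS, List.foldr_cons, List.foldr_nil,
      premLv_eq_prem _ hz]
  rw [hpre]
  set J := ini (Cs.getD k 0)
  set Q := pquo (Cs.getD l 0) J (y l)
  set R := prem (Cs.getD l 0) J (y l)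
  have hQR : Q * J + R = lcv (y l) J ^ _ * Cs.getD l 0 := pquo_mul_add_prem _ _ _
  have hRl : R.degreeOf (y l) < J.degreeOf (y l) :=
    degreeOf_prem_lt _ (degreeOf_pos_of_cls hz)
  have hRj : ∀ j, y l < j → R.degreeOf j = 0 := fun j hj => by
    have := degreeOf_prem_le (Cs.getD l 0) hj.ne' (degreeOf_eq_zero_of_cls hz hj)
    rw [degreeOf_eq_zero_of_cls (hy l hl) hj] at this
    exact Nat.le_zero.mp this
  have hQj : ∀ j, y l < j → Q.degreeOf j = 0 := fun j hj =>
    degreeOf_pquo hj.ne' (degreeOf_eq_zero_of_cls (hy l hl) hj) (degreeOf_eq_zero_of_cls hz hj)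
  obtain ⟨⟨h, h0, hhp, hmem⟩, hMlt, hMle⟩ := premTS_take_spec hy hmono
    (fun j => n - Cs.length ≤ j) hkr.le hfree (Q * Cs.getD k 0)
  obtain ⟨⟨h', h0', hhp', hmem'⟩, hRlt, hRle⟩ := premTS_take_spec hy hmono
    (fun j => n - Cs.length ≤ j) hl.le (fun i hi => hfree i (hi.trans hlk)) R
  set M := premTS (Q * Cs.getD k 0) (Cs.take k)
  set R' := premTS R (Cs.take l)
  set S := (fun i => Cs.getD i 0) '' Set.Iio k
  set d := (Cs.getD k 0).degreeOf (y k)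
  have hyl : ∀ i < Cs.length, n - Cs.length ≤ (y i : ℕ) := fun i hi => by
    rw [hyval i hi]
    omega
  have hspan : Ideal.span S ≤ I := by
    rw [Ideal.span_le]
    rintro _ ⟨i, hi, rfl⟩
    exact hW.getD_mem (lt_trans hi hkr)
  have hMI : M ∈ I := by
    have h1 : h * (Q * Cs.getD k 0) ∈ I :=
      Ideal.mul_mem_left _ _ (Ideal.mul_mem_left _ _ (hW.getD_mem hkr))
    have := sub_mem h1 (hspan hmem)
    rwa [sub_sub_cancel] at this
  have hykl : y l < y k := hmono l k hlk hkr
  have hMdeg : M.degreeOf (y k) ≤ d := by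
    refine (hMle _ fun i hi => hmono i k hi hkr).trans ((degreeOf_mul_le _ _ _).trans ?_)
    rw [hQj _ hykl, zero_add]
  have hMgt : ∀ j, y k < j → M.degreeOf j = 0 := fun j hj => by
    refine Nat.le_zero.mp ((hMle j fun i hi => (hmono i k hi hkr).trans hj).trans ?_)
    rw [degreeOf_mul_eq_zero (hQj j (hykl.trans hj)) (degreeOf_eq_zero_of_cls (hy k hkr) hj)]
  have hMd : coefv (y k) d M + h * R ∈ Ideal.span S := by
    have h1 := coefv_mem_span (i := y k) d (by
      rintro _ ⟨i, hi, rfl⟩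
      exact degreeOf_eq_zero_of_cls (hy i (lt_trans hi hkr)) (hmono i k hi hkr)) hmem
    rw [coefv_sub, ← mul_assoc, mul_comm, coefv_mul_of_degreeOf_eq_zero _ _ _
      (degreeOf_mul_eq_zero (hhp _ (hyl k hkr)) (hQj _ hykl))] at h1
    have hJ : coefv (y k) d (Cs.getD k 0) = J := (ini_eq_lcv (hy k hkr)).symm
    rw [hJ] at h1
    have h2 : h * (Q * J + R) ∈ Ideal.span S := by
      rw [hQR]
      exact Ideal.mul_mem_left _ _ (Ideal.mul_mem_left _ _ (Ideal.subset_span ⟨l, hlk, rfl⟩))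
    have := sub_mem h2 h1
    convert this using 1
    ring
  have hcomb : h' * coefv (y k) d M + h * R' ∈ Ideal.span S := by
    have h1 : h' * R - R' ∈ Ideal.span S :=
      Ideal.span_mono (Set.image_mono (Set.Iio_subset_Iio hlk.le)) hmem'
    have := sub_mem (Ideal.mul_mem_left _ h' hMd) (Ideal.mul_mem_left _ h h1)
    convert this using 1
    ring
  have hR'l : R'.degreeOf (y l) < J.degreeOf (y l) :=
    (hRle _ fun i hi => hmono i l hi hl).trans_lt hRl
  have hR'j : ∀ j, y l < j → R'.degreeOf j = 0 := fun j hj =>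
    Nat.le_zero.mp (hRj j hj ▸ hRle j fun i hi => (hmono i l hi hl).trans hj)
  have hzero : h' * coefv (y k) d M + h * R' = 0 := by
    refine hW.eq_zero_of_reduced hy (hspan hcomb) fun i hi => ?_
    have hle : (h' * coefv (y k) d M + h * R').degreeOf (y i) ≤
        max ((coefv (y k) d M).degreeOf (y i)) (R'.degreeOf (y i)) := by
      refine (degreeOf_add_le _ _ _).trans (max_le_max ?_ ?_)
      · exact (degreeOf_mul_le _ _ _).trans (by rw [hhp' _ (hyl i hi), zero_add])
      · exact (degreeOf_mul_le _ _ _).trans (by rw [hhp _ (hyl i hi), zero_add])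
    have hpos := degreeOf_pos_of_cls (hy i hi)
    refine hle.trans_lt (max_lt ?_ ?_)
    · rcases lt_trichotomy i k with hik | rfl | hik
      · exact (degreeOf_coefv_le _ _ _ _).trans_lt (hMlt i hik)
      · rwa [degreeOf_coefv_self]
      · refine (degreeOf_coefv_le _ _ _ _).trans_lt ?_
        rwa [hMgt _ (hmono k i hik hi)]
    · rcases lt_trichotomy i l with hil | rfl | hil
      · exact hRlt i hil
      · exact hR'l.trans hred
      · rwa [hR'j _ (hmono l i hil hi)]
  have hco : ∀ j : Fin n, n - Cs.length ≤ j →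
      (coefv (y k) d M).degreeOf j ≤ R'.degreeOf j := fun j hj =>
    degreeOf_le_of_mul_add_mul_eq_zero h0' (hhp' j hj) (hhp j hj) hzero
  have hM0 : M = 0 := by
    refine hW.eq_zero_of_coefv hy hmono hkr hz hMI hMlt hMdeg hMgt
      ((hco _ (hyl l hl)).trans_lt hR'l) fun j hj => ?_
    exact Nat.le_zero.mp
      (hR'j j hj ▸ hco j ((hyl l hl).trans (Fin.lt_def.mp hj).le))
  refine ⟨?_, hM0⟩
  rw [hM0, coefv_zero, mul_zero, zero_add] at hzero
  exact (mul_eq_zero.mp hzero).resolve_left h0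

end CharSets
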